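/- Let U ⊆ ℝ^{N+M} be a definable family in a fixed o-minimal structure S. Then there exists an integer n such that every fiber U_t, for t ∈ ℝ^M, has at most n connected components. -/

import Mathlib

/-- Semialgebraic subsets of `ℝ^k`: the smallest collection of sets containing the zero sets and
positivity sets of real polynomials which is stable under finite unions, finite intersections and
complements. -/
inductive IsSemialgebraic : {k : ℕ} → Set (Fin k → ℝ) → Prop
  | zero_set {k : ℕ} (p : MvPolynomial (Fin k) ℝ) :
      IsSemialgebraic {x | MvPolynomial.eval x p = 0}
  | pos_set {k : ℕ} (p : MvPolynomial (Fin k) ℝ) :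
      IsSemialgebraic {x | 0 < MvPolynomial.eval x p}
  | union {k : ℕ} {s t : Set (Fin k → ℝ)} :
      IsSemialgebraic s → IsSemialgebraic t → IsSemialgebraic (s ∪ t)
  | inter {k : ℕ} {s t : Set (Fin k → ℝ)} :
      IsSemialgebraic s → IsSemialgebraic t → IsSemialgebraic (s ∩ t)
  | compl {k : ℕ} {s : Set (Fin k → ℝ)} : IsSemialgebraic s → IsSemialgebraic sᶜ

/-- A *structure* (expanding the real field): a collection `sets N` of subsets of `ℝ^N` for each
`N`, such that each `sets N` is a boolean algebra containing all semialgebraic sets, and the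
collection is stable under cartesian products and coordinate projections. -/
structure RealStructure where
  sets : (k : ℕ) → Set (Set (Fin k → ℝ))
  union_mem : ∀ k, ∀ s ∈ sets k, ∀ t ∈ sets k, s ∪ t ∈ sets k
  compl_mem : ∀ k, ∀ s ∈ sets k, sᶜ ∈ sets k
  semialgebraic_mem : ∀ (k) (s : Set (Fin k → ℝ)), IsSemialgebraic s → s ∈ sets k
  prod_mem : ∀ k l, ∀ s ∈ sets k, ∀ t ∈ sets l,
    {z : Fin (k + l) → ℝ |
      (fun i => z (Fin.castAdd l i)) ∈ s ∧ (fun j => z (Fin.natAdd k j)) ∈ t} ∈ sets (k + l)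
  proj_mem : ∀ k l, ∀ s ∈ sets (k + l),
    {x : Fin k → ℝ | ∃ y : Fin l → ℝ, Fin.append x y ∈ s} ∈ sets k

/-- A structure is *o-minimal* if the definable subsets of `ℝ` are exactly the finite unions of
open intervals (possibly unbounded) and points. -/
def RealStructure.IsOMinimal (S : RealStructure) : Prop :=
  ∀ s ∈ S.sets 1, ∃ (r : ℕ) (a b : Fin r → EReal) (F : Finset ℝ),
    s = {x : Fin 1 → ℝ | (∃ i, a i < (x 0 : EReal) ∧ (x 0 : EReal) < b i) ∨ x 0 ∈ F}

/-- The `H₁`-height of a rational number `p/q` in lowest terms: `max(|p|, |q|)`. -/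
def ratH (q : ℚ) : ℝ := max |(q.num : ℝ)| (q.den : ℝ)


/-- A function on `ℝ^k` which is given by a polynomial. -/
def IsPolyFun {k : ℕ} (f : (Fin k → ℝ) → ℝ) : Prop :=
  ∃ p : MvPolynomial (Fin k) ℝ, ∀ x, MvPolynomial.eval x p = f x

namespace IsPolyFun

variable {k : ℕ} {f g : (Fin k → ℝ) → ℝ}

theorem const (c : ℝ) : IsPolyFun fun _ : Fin k → ℝ => c :=
  ⟨MvPolynomial.C c, fun x => by simp⟩

theorem coord (i : Fin k) : IsPolyFun fun x : Fin k → ℝ => x i :=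
  ⟨MvPolynomial.X i, fun x => by simp⟩

theorem add (hf : IsPolyFun f) (hg : IsPolyFun g) : IsPolyFun fun x => f x + g x := by
  obtain ⟨p, hp⟩ := hf
  obtain ⟨q, hq⟩ := hg
  exact ⟨p + q, fun x => by simp [hp, hq]⟩

theorem sub (hf : IsPolyFun f) (hg : IsPolyFun g) : IsPolyFun fun x => f x - g x := by
  obtain ⟨p, hp⟩ := hf
  obtain ⟨q, hq⟩ := hg
  exact ⟨p - q, fun x => by simp [hp, hq]⟩

theorem div_const (hf : IsPolyFun f) (c : ℝ) : IsPolyFun fun x => f x / c := by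
  obtain ⟨p, hp⟩ := hf
  exact ⟨p * MvPolynomial.C c⁻¹, fun x => by simp [hp, div_eq_mul_inv]⟩

theorem comp_coord {l : ℕ} (hf : IsPolyFun f) (σ : Fin k → Fin l) :
    IsPolyFun fun x : Fin l → ℝ => f fun i => x (σ i) := by
  obtain ⟨p, hp⟩ := hf
  exact ⟨MvPolynomial.rename σ p, fun x => by rw [MvPolynomial.eval_rename, hp]; rfl⟩

theorem snoc {m : ℕ} {F : (Fin k → ℝ) → Fin m → ℝ} (hF : ∀ i, IsPolyFun fun x => F x i)
    (hg : IsPolyFun g) (i : Fin (m + 1)) :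
    IsPolyFun fun x => (Fin.snoc (F x) (g x) : Fin (m + 1) → ℝ) i := by
  induction i using Fin.lastCases with
  | last => simpa using hg
  | cast i => simpa using hF i

theorem cons {m : ℕ} {F : (Fin k → ℝ) → Fin m → ℝ} (hg : IsPolyFun g)
    (hF : ∀ i, IsPolyFun fun x => F x i) (i : Fin (m + 1)) :
    IsPolyFun fun x => (Fin.cons (g x) (F x) : Fin (m + 1) → ℝ) i := by
  induction i using Fin.cases with
  | zero => simpa using hg
  | succ i => simpa using hF i

theorem append {m n : ℕ} {F : (Fin k → ℝ) → Fin m → ℝ} {G : (Fin k → ℝ) → Fin n → ℝ}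
    (hF : ∀ i, IsPolyFun fun x => F x i) (hG : ∀ i, IsPolyFun fun x => G x i) (i : Fin (m + n)) :
    IsPolyFun fun x => Fin.append (F x) (G x) i := by
  induction i using Fin.addCases with
  | left i => simpa using hF i
  | right i => simpa using hG i

end IsPolyFun

namespace RealStructure

/-- A predicate on `ℝ^k` which cuts out a set of the structure. -/
def Def (S : RealStructure) {k : ℕ} (P : (Fin k → ℝ) → Prop) : Prop :=
  {x | P x} ∈ S.sets k

/-- A definable relation between `ℝ^m` and `ℝ^n`. -/
def DefRel (S : RealStructure) {m n : ℕ} (P : (Fin m → ℝ) → (Fin n → ℝ) → Prop) : Prop :=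
  S.Def fun z : Fin (m + n) → ℝ => P (fun i => z (Fin.castAdd n i)) fun j => z (Fin.natAdd m j)

/-- A definable relation between `ℝ^m` and `ℝ`. -/
def DefRel₁ (S : RealStructure) {m : ℕ} (P : (Fin m → ℝ) → ℝ → Prop) : Prop :=
  S.Def fun z : Fin (m + 1) → ℝ => P (fun i => z i.castSucc) (z (Fin.last m))

variable {S : RealStructure} {k : ℕ} {P Q : (Fin k → ℝ) → Prop} {f g h : (Fin k → ℝ) → ℝ}

namespace Def

theorem not (hP : S.Def P) : S.Def fun x => ¬ P x := S.compl_mem k _ hP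

theorem or (hP : S.Def P) (hQ : S.Def Q) : S.Def fun x => P x ∨ Q x := S.union_mem k _ hP _ hQ

theorem and (hP : S.Def P) (hQ : S.Def Q) : S.Def fun x => P x ∧ Q x := by
  have := (hP.not.or hQ.not).not
  simpa only [not_or, not_not] using this

theorem imp (hP : S.Def P) (hQ : S.Def Q) : S.Def fun x => P x → Q x := by
  have := hP.not.or hQ
  simpa only [← imp_iff_not_or] using this

theorem lt (hf : IsPolyFun f) (hg : IsPolyFun g) : S.Def fun x => f x < g x := by
  obtain ⟨p, hp⟩ := hg.sub hf
  have := S.semialgebraic_mem k _ (.pos_set p)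
  simpa only [Def, hp, sub_pos] using this

theorem eq (hf : IsPolyFun f) (hg : IsPolyFun g) : S.Def fun x => f x = g x := by
  obtain ⟨p, hp⟩ := hf.sub hg
  have := S.semialgebraic_mem k _ (.zero_set p)
  simpa only [Def, hp, sub_eq_zero] using this

theorem abs_sub_lt (hf : IsPolyFun f) (hg : IsPolyFun g) (hh : IsPolyFun h) :
    S.Def fun x => |f x - g x| < h x := by
  have := (lt (S := S) (hf.sub hg) hh).and (lt (hg.sub hf) hh)
  simpa only [abs_sub_lt_iff] using this

theorem const (p : Prop) : S.Def fun _ : Fin k → ℝ => p := by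
  by_cases hp : p
  · simpa only [hp] using eq (S := S) (.const (k := k) 0) (.const 0)
  · simpa [hp] using eq (S := S) (.const (k := k) 0) (.const 1)

theorem all_finset {ι : Type*} (s : Finset ι) {R : ι → (Fin k → ℝ) → Prop}
    (hR : ∀ i, S.Def (R i)) : S.Def fun x => ∀ i ∈ s, R i x := by
  classical
  induction s using Finset.induction_on with
  | empty => simpa using const (S := S) (k := k) True
  | insert a s _ ih => simpa only [Finset.forall_mem_insert] using (hR a).and ih

theorem ex_finset {ι : Type*} (s : Finset ι) {R : ι → (Fin k → ℝ) → Prop}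
    (hR : ∀ i, S.Def (R i)) : S.Def fun x => ∃ i ∈ s, R i x := by
  have := (all_finset s fun i => (hR i).not).not
  simpa only [not_forall, not_not, exists_prop] using this

theorem all_fin {n : ℕ} {R : Fin n → (Fin k → ℝ) → Prop}
    (hR : ∀ i, S.Def (R i)) : S.Def fun x => ∀ i, R i x := by
  simpa using all_finset Finset.univ hR

theorem exVec {l : ℕ} {R : (Fin k → ℝ) → (Fin l → ℝ) → Prop}
    (hR : S.Def fun z : Fin (k + l) → ℝ =>
      R (fun i => z (Fin.castAdd l i)) fun j => z (Fin.natAdd k j)) :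
    S.Def fun x => ∃ y, R x y := by
  have := S.proj_mem k l _ hR
  simpa only [Def, Set.mem_ofPred_eq, Fin.append_left, Fin.append_right] using this

theorem allVec {l : ℕ} {R : (Fin k → ℝ) → (Fin l → ℝ) → Prop}
    (hR : S.Def fun z : Fin (k + l) → ℝ =>
      R (fun i => z (Fin.castAdd l i)) fun j => z (Fin.natAdd k j)) :
    S.Def fun x => ∀ y, R x y := by
  have := (exVec (R := fun x y => ¬ R x y) hR.not).not
  simpa only [not_exists, not_not] using this

theorem ex {R : (Fin k → ℝ) → ℝ → Prop}
    (hR : S.Def fun z : Fin (k + 1) → ℝ => R (fun i => z i.castSucc) (z (Fin.last k))) :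
    S.Def fun x => ∃ y, R x y := by
  have := exVec (l := 1) (R := fun x y => R x (y 0)) hR
  have e : ∀ x, (∃ y : Fin 1 → ℝ, R x (y 0)) ↔ ∃ y, R x y :=
    fun x => ⟨fun ⟨y, hy⟩ => ⟨_, hy⟩, fun ⟨y, hy⟩ => ⟨fun _ => y, hy⟩⟩
  simpa only [e] using this

theorem all {R : (Fin k → ℝ) → ℝ → Prop}
    (hR : S.Def fun z : Fin (k + 1) → ℝ => R (fun i => z i.castSucc) (z (Fin.last k))) :
    S.Def fun x => ∀ y, R x y := by
  have := (ex (R := fun x y => ¬ R x y) hR.not).not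
  simpa only [not_exists, not_not] using this

theorem subst {l : ℕ} (hP : S.Def P) {F : (Fin l → ℝ) → Fin k → ℝ}
    (hF : ∀ i, IsPolyFun fun x => F x i) : S.Def fun x => P (F x) := by
  have h₁ : S.Def fun z : Fin (l + k) → ℝ => P fun j => z (Fin.natAdd l j) := by
    have := S.prod_mem l k _ (const (S := S) True) _ hP
    simpa [Def] using this
  have h₂ : S.Def fun z : Fin (l + k) → ℝ =>
      ∀ j, z (Fin.natAdd l j) = F (fun i => z (Fin.castAdd k i)) j :=
    all_fin fun j => eq (.coord _) ((hF j).comp_coord _)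
  have := exVec (R := fun x y => P y ∧ ∀ j, y j = F x j) (h₁.and h₂)
  have e : ∀ x, (∃ y, P y ∧ ∀ j, y j = F x j) ↔ P (F x) := fun x =>
    ⟨fun ⟨y, hy, h⟩ => (funext h : y = F x) ▸ hy, fun h => ⟨_, h, fun _ => rfl⟩⟩
  simpa only [e] using this

end Def

theorem DefRel.app {m n : ℕ} {R : (Fin m → ℝ) → (Fin n → ℝ) → Prop} (hR : S.DefRel R)
    {F : (Fin k → ℝ) → Fin m → ℝ} {G : (Fin k → ℝ) → Fin n → ℝ}
    (hF : ∀ i, IsPolyFun fun x => F x i) (hG : ∀ i, IsPolyFun fun x => G x i) :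
    S.Def fun x => R (F x) (G x) := by
  have := Def.subst hR (IsPolyFun.append hF hG)
  simpa using this

theorem DefRel₁.app {m : ℕ} {R : (Fin m → ℝ) → ℝ → Prop} (hR : S.DefRel₁ R)
    {F : (Fin k → ℝ) → Fin m → ℝ} (hF : ∀ i, IsPolyFun fun x => F x i) (hg : IsPolyFun g) :
    S.Def fun x => R (F x) (g x) := by
  have := Def.subst hR (IsPolyFun.snoc hF hg)
  simpa using this

/-- A definable subset of the line. -/
def DefSet (S : RealStructure) (s : Set ℝ) : Prop := S.Def fun x : Fin 1 → ℝ => x 0 ∈ s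

namespace IsOMinimal

variable {s : Set ℝ}

theorem exists_eq (hS : S.IsOMinimal) (hs : S.DefSet s) :
    ∃ (r : ℕ) (a b : Fin r → EReal) (F : Finset ℝ),
      s = (⋃ i, Real.toEReal ⁻¹' Set.Ioo (a i) (b i)) ∪ F := by
  obtain ⟨r, a, b, F, h⟩ := hS _ hs
  refine ⟨r, a, b, F, Set.ext fun x => ?_⟩
  have := Set.ext_iff.1 h fun _ => x
  simpa using this

theorem finite_of_countable (hS : S.IsOMinimal) (hs : S.DefSet s) (hc : s.Countable) :
    s.Finite := by
  obtain ⟨r, a, b, F, rfl⟩ := hS.exists_eq hs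
  refine Set.Finite.union (Set.finite_iUnion fun i => ?_) F.finite_toSet
  rw [Set.eq_empty_of_forall_notMem (s := Real.toEReal ⁻¹' Set.Ioo (a i) (b i))]
  · exact Set.finite_empty
  intro x hx
  have ho : IsOpen (Real.toEReal ⁻¹' Set.Ioo (a i) (b i)) :=
    isOpen_Ioo.preimage continuous_coe_real_ereal
  have hc' : (Real.toEReal ⁻¹' Set.Ioo (a i) (b i)).Countable :=
    hc.mono ((Set.subset_iUnion (fun i => Real.toEReal ⁻¹' Set.Ioo (a i) (b i)) i).trans
      Set.subset_union_left)
  exact (ho.measure_pos MeasureTheory.volume ⟨x, hx⟩).ne' (hc'.measure_zero _)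

theorem finite_frontier (hS : S.IsOMinimal) (hs : S.DefSet s) : (frontier s).Finite := by
  obtain ⟨r, a, b, F, rfl⟩ := hS.exists_eq hs
  have h₁ : ∀ i, (frontier (Real.toEReal ⁻¹' Set.Ioo (a i) (b i))).Finite := fun i => by
    have hsub : frontier (Set.Ioo (a i) (b i)) ⊆ {a i, b i} := by
      rw [isOpen_Ioo.frontier_eq]
      rintro x ⟨hx, hx'⟩
      obtain ⟨ha, hb⟩ := closure_minimal Set.Ioo_subset_Icc_self isClosed_Icc hx
      rcases ha.eq_or_lt with ha | ha
      · exact Or.inl ha.symm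
      · exact Or.inr (hb.eq_or_lt.resolve_right fun hb => hx' ⟨ha, hb⟩)
    exact (((Set.toFinite {a i, b i}).subset hsub).preimage
      EReal.coe_injective.injOn).subset
        (continuous_coe_real_ereal.frontier_preimage_subset _)
  refine ((Set.finite_iUnion h₁).union F.finite_toSet).subset ?_
  rintro x ⟨hx, hx'⟩
  rw [closure_union, closure_iUnion_of_finite, F.finite_toSet.isClosed.closure_eq] at hx
  refine hx.imp_left fun h => ?_
  obtain ⟨i, hi⟩ := Set.mem_iUnion.1 h
  exact Set.mem_iUnion.2 ⟨i, hi, fun h => hx' (interior_mono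
    ((Set.subset_iUnion (fun i => Real.toEReal ⁻¹' Set.Ioo (a i) (b i)) i).trans
      Set.subset_union_left) h)⟩

/-- A definable subset of the line is finite if it is contained in the union of the frontiers of
countably many definable sets. -/
theorem finite_of_subset_frontier (hS : S.IsOMinimal) (hs : S.DefSet s) {ι : Type*} [Countable ι]
    {W : ι → Set ℝ} (hW : ∀ i, S.DefSet (W i)) (h : ∀ x ∈ s, ∃ i, x ∈ frontier (W i)) :
    s.Finite :=
  hS.finite_of_countable hs <|
    (Set.countable_iUnion fun i => (hS.finite_frontier (hW i)).countable).mono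
      fun x hx => Set.mem_iUnion.2 (h x hx)

end IsOMinimal

end RealStructure

/-- Near `x`, the fibres of `A` are uniformly separated and move by less than half of the separation
bound. -/
def StableAt (A : ℝ → ℝ → Prop) (x : ℝ) : Prop :=
  ∃ δ η : ℝ, 0 < δ ∧ 0 < η ∧ ∀ x₁ x₂, |x₁ - x| < δ → |x₂ - x| < δ →
    (∀ y₁ y₂, A x₁ y₁ → A x₁ y₂ → |y₁ - y₂| < η → y₁ = y₂) ∧
      ∀ y₁, A x₁ y₁ → ∃ y₂, A x₂ y₂ ∧ |y₁ - y₂| < η / 2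

theorem StableAt.eventually_ncard_eq {A : ℝ → ℝ → Prop} {x : ℝ} (h : StableAt A x)
    (hA : ∀ x, {y | A x y}.Finite) :
    ∀ᶠ x' in nhds x, {y | A x' y}.ncard = {y | A x y}.ncard := by
  obtain ⟨δ, η, hδ, hη, h⟩ := h
  have key : ∀ x₁ x₂, |x₁ - x| < δ → |x₂ - x| < δ →
      {y | A x₁ y}.ncard ≤ {y | A x₂ y}.ncard := fun x₁ x₂ h₁ h₂ => by
    obtain ⟨hsep, hnear⟩ := h x₁ x₂ h₁ h₂
    choose! φ hφ hφ' using hnear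
    refine Set.ncard_le_ncard_of_injOn φ hφ (fun y hy y' hy' e => hsep y y' hy hy' ?_) (hA x₂)
    have a := abs_lt.1 (hφ' y hy)
    have b := abs_lt.1 (hφ' y' hy')
    rw [abs_lt]
    constructor <;> linarith [a.1, a.2, b.1, b.2]
  filter_upwards [Metric.ball_mem_nhds x hδ] with x' hx'
  rw [Metric.mem_ball, Real.dist_eq] at hx'
  have hx : |x - x| < δ := by simpa using hδ
  exact le_antisymm (key _ _ hx' hx) (key _ _ hx hx')

theorem ncard_eq_of_stableAt {A : ℝ → ℝ → Prop} (hA : ∀ x, {y | A x y}.Finite) {J : Set ℝ}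
    (hJ : IsPreconnected J) (h : ∀ x ∈ J, StableAt A x) {a b : ℝ} (ha : a ∈ J) (hb : b ∈ J) :
    {y | A a y}.ncard = {y | A b y}.ncard := by
  refine hJ.constant (f := fun x => {y | A x y}.ncard) (fun x hx => ?_) ha hb
  exact ContinuousAt.continuousWithinAt
    (continuousAt_const.congr ((h x hx).eventually_ncard_eq hA |>.mono fun _ e => e.symm))

/-- The sample points attached to `B`. If `B` is finite, then there are finitely many of them, and every
point outside `B` can be joined to one of them by a segment which avoids `B`. -/
def IsSample (B : ℝ → Prop) (σ : ℝ) : Prop :=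
  σ = 0 ∨ ∃ b, B b ∧ ∃ b', B b' ∧ (σ = (b + b') / 2 ∨ σ = b + 1 ∨ σ = b - 1)

theorem finite_isSample {B : ℝ → Prop} (hB : {b | B b}.Finite) : {σ | IsSample B σ}.Finite := by
  refine ((Set.finite_singleton (0 : ℝ)).union (((hB.prod hB).image
    fun p => (p.1 + p.2) / 2).union ((hB.image fun b => b + 1).union
      (hB.image fun b => b - 1)))).subset ?_
  rintro σ (rfl | ⟨b, hb, b', hb', rfl | rfl | rfl⟩)
  · simp
  · exact Or.inr (Or.inl ⟨(b, b'), ⟨hb, hb'⟩, rfl⟩)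
  · exact Or.inr (Or.inr (Or.inl ⟨b, hb, rfl⟩))
  · exact Or.inr (Or.inr (Or.inr ⟨b, hb, rfl⟩))

theorem exists_isSample {B : ℝ → Prop} (hB : {b | B b}.Finite) (x : ℝ) :
    ∃ σ, IsSample B σ ∧ (σ = x ∨ ∀ y ∈ Set.uIcc σ x, ¬ B y) := by
  by_cases hx : B x
  · exact ⟨x, Or.inr ⟨x, hx, x, hx, Or.inl (by ring)⟩, Or.inl rfl⟩
  have hlow : (∀ b, B b → x < b) ∨ ∃ b, B b ∧ b < x ∧ ∀ c, B c → c ≤ b ∨ x < c := by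
    rcases Set.eq_empty_or_nonempty ({b | B b} ∩ Set.Iio x) with h | h
    · refine Or.inl fun b hb => lt_of_not_ge fun hbx => ?_
      have : b ∈ ({b | B b} ∩ Set.Iio x) :=
        ⟨hb, lt_of_le_of_ne hbx fun e => hx (e ▸ hb)⟩
      simp [h] at this
    · obtain ⟨b, ⟨hb, hbx⟩, hmax⟩ := Set.exists_max_image _ id (hB.inter_of_left _) h
      refine Or.inr ⟨b, hb, hbx, fun c hc => ?_⟩
      rcases lt_or_ge x c with h | h
      · exact Or.inr h
      · exact Or.inl (hmax c ⟨hc, lt_of_le_of_ne h fun e => hx (e ▸ hc)⟩)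
  have hupp : (∀ b, B b → b < x) ∨ ∃ b, B b ∧ x < b ∧ ∀ c, B c → b ≤ c ∨ c < x := by
    rcases Set.eq_empty_or_nonempty ({b | B b} ∩ Set.Ioi x) with h | h
    · refine Or.inl fun b hb => lt_of_not_ge fun hbx => ?_
      have : b ∈ ({b | B b} ∩ Set.Ioi x) :=
        ⟨hb, lt_of_le_of_ne hbx fun e => hx (e ▸ hb)⟩
      simp [h] at this
    · obtain ⟨b, ⟨hb, hbx⟩, hmin⟩ := Set.exists_min_image _ id (hB.inter_of_left _) h
      refine Or.inr ⟨b, hb, hbx, fun c hc => ?_⟩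
      rcases lt_or_ge c x with h | h
      · exact Or.inr h
      · exact Or.inl (hmin c ⟨hc, lt_of_le_of_ne h fun e => hx (e ▸ hc)⟩)
  have huIcc : ∀ {σ y : ℝ}, y ∈ Set.uIcc σ x → σ ≤ y ∧ y ≤ x ∨ x ≤ y ∧ y ≤ σ :=
    fun h => Set.mem_uIcc.1 h
  rcases hlow with hlow | ⟨b, hb, hbx, hlow⟩ <;> rcases hupp with hupp | ⟨b', hb', hbx', hupp⟩
  · exact ⟨0, Or.inl rfl, Or.inr fun y _ hy => lt_asymm (hlow y hy) (hupp y hy)⟩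
  · refine ⟨b' - 1, Or.inr ⟨b', hb', b', hb', by simp⟩, Or.inr fun y hy hBy => ?_⟩
    have := hlow y hBy
    rcases hupp y hBy with h | h <;> rcases huIcc hy with h' | h' <;> linarith [h'.1, h'.2]
  · refine ⟨b + 1, Or.inr ⟨b, hb, b, hb, by simp⟩, Or.inr fun y hy hBy => ?_⟩
    have := hupp y hBy
    rcases hlow y hBy with h | h <;> rcases huIcc hy with h' | h' <;> linarith [h'.1, h'.2]
  · refine ⟨(b + b') / 2, Or.inr ⟨b, hb, b', hb', Or.inl rfl⟩, Or.inr fun y hy hBy => ?_⟩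
    rcases hupp y hBy with h | h <;> rcases hlow y hBy with h'' | h'' <;>
      rcases huIcc hy with h' | h' <;> linarith [h'.1, h'.2]

/-- A fibre with separation bound `1 / (n + 1)` which is approximated by the finite set `Q` up to a
quarter of that bound. -/
def ApproxBy (A : ℝ → ℝ → Prop) (n : ℕ) (Q : Finset ℚ) (x : ℝ) : Prop :=
  (∀ y₁ y₂, A x y₁ → A x y₂ → |y₁ - y₂| < 1 / (n + 1 : ℝ) → y₁ = y₂) ∧
    (∀ y, A x y → ∃ q ∈ Q, |y - q| < 1 / (n + 1 : ℝ) / 4) ∧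
      ∀ q ∈ Q, ∃ y, A x y ∧ |y - q| < 1 / (n + 1 : ℝ) / 4

theorem exists_approxBy {A : ℝ → ℝ → Prop} {x : ℝ} (hA : {y | A x y}.Finite) :
    ∃ n Q, ApproxBy A n Q x := by
  classical
  have h₁ : ∀ᶠ n : ℕ in Filter.atTop, ∀ p ∈ {y | A x y} ×ˢ {y | A x y},
      |p.1 - p.2| < 1 / (n + 1 : ℝ) → p.1 = p.2 := by
    rw [Filter.eventually_all_finite (hA.prod hA)]
    intro p _
    by_cases hp : p.1 = p.2
    · exact Filter.Eventually.of_forall fun _ _ => hp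
    · have := (tendsto_one_div_add_atTop_nhds_zero_nat (𝕜 := ℝ)).eventually_lt_const
        (abs_pos.2 (sub_ne_zero.2 hp))
      filter_upwards [this] with n hn h
      exact absurd h hn.not_gt
  obtain ⟨n, hn⟩ := h₁.exists
  have hpos : (0 : ℝ) < 1 / (n + 1 : ℝ) / 4 := by positivity
  have : ∀ y : ℝ, ∃ q : ℚ, |y - q| < 1 / (n + 1 : ℝ) / 4 := fun y => by
    obtain ⟨q, hq, hq'⟩ := exists_rat_btwn (sub_lt_self y hpos)
    exact ⟨q, by rw [abs_lt]; constructor <;> linarith⟩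
  choose r hr using this
  refine ⟨n, hA.toFinset.image r, fun y₁ y₂ h₁ h₂ => hn (y₁, y₂) ⟨h₁, h₂⟩, fun y hy =>
    ⟨r y, Finset.mem_image_of_mem r (hA.mem_toFinset.2 hy), hr y⟩, fun q hq => ?_⟩
  obtain ⟨y, hy, rfl⟩ := Finset.mem_image.1 hq
  exact ⟨y, hA.mem_toFinset.1 hy, hr y⟩

theorem stableAt_of_mem_interior {A : ℝ → ℝ → Prop} {n : ℕ} {Q : Finset ℚ} {x : ℝ}
    (h : x ∈ interior {x | ApproxBy A n Q x}) : StableAt A x := by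
  obtain ⟨δ, hδ, hsub⟩ := Metric.mem_nhds_iff.1 (mem_interior_iff_mem_nhds.1 h)
  refine ⟨δ, 1 / (n + 1 : ℝ), hδ, by positivity, fun x₁ x₂ h₁ h₂ => ?_⟩
  obtain ⟨hsep, hnear, -⟩ := hsub (show x₁ ∈ Metric.ball x δ from h₁)
  obtain ⟨-, -, hnear'⟩ := hsub (show x₂ ∈ Metric.ball x δ from h₂)
  refine ⟨hsep, fun y hy => ?_⟩
  obtain ⟨q, hq, hyq⟩ := hnear y hy
  obtain ⟨y', hy', hyq'⟩ := hnear' q hq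
  refine ⟨y', hy', ?_⟩
  rw [abs_lt] at *
  constructor <;> linarith [hyq.1, hyq.2, hyq'.1, hyq'.2]

namespace RealStructure

variable {S : RealStructure} {m : ℕ}

theorem DefRel₁.defSet {R : (Fin m → ℝ) → ℝ → Prop} (hR : S.DefRel₁ R) (t : Fin m → ℝ) :
    S.DefSet {x | R t x} :=
  hR.app (fun _ => .const _) (.coord 0)

theorem defRel₁_stableAt {A : (Fin (m + 1) → ℝ) → ℝ → Prop} (hA : S.DefRel₁ A) :
    S.DefRel₁ fun (t : Fin m → ℝ) x => StableAt (fun x y => A (Fin.snoc t x) y) x := by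
  unfold StableAt
  refine .ex <| .ex <| .and (.lt (.const _) (.coord _)) <| .and (.lt (.const _) (.coord _)) <|
    .all <| .all <| .imp (.abs_sub_lt (.coord _) (.coord _) (.coord _)) <|
    .imp (.abs_sub_lt (.coord _) (.coord _) (.coord _)) <| .and (.all <| .all ?_) (.all ?_)
  · exact .imp (hA.app (.snoc (fun _ => .coord _) (.coord _)) (.coord _)) <|
      .imp (hA.app (.snoc (fun _ => .coord _) (.coord _)) (.coord _)) <|
      .imp (.abs_sub_lt (.coord _) (.coord _) (.coord _)) (.eq (.coord _) (.coord _))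
  · exact .imp (hA.app (.snoc (fun _ => .coord _) (.coord _)) (.coord _)) <| .ex <|
      .and (hA.app (.snoc (fun _ => .coord _) (.coord _)) (.coord _)) <|
      .abs_sub_lt (.coord _) (.coord _) (.div_const (.coord _) 2)

theorem defSet_approxBy {A : (Fin (m + 1) → ℝ) → ℝ → Prop} (hA : S.DefRel₁ A)
    (t : Fin m → ℝ) (n : ℕ) (Q : Finset ℚ) :
    S.DefSet {x | ApproxBy (fun x y => A (Fin.snoc t x) y) n Q x} := by
  have hA' : ∀ {k : ℕ} (i j : Fin k),
      S.Def fun z : Fin k → ℝ => A (Fin.snoc t (z i)) (z j) := fun i j =>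
    hA.app (.snoc (fun _ => .const _) (.coord _)) (.coord _)
  refine .and (.all <| .all ?_) (.and (.all ?_) ?_)
  · exact .imp (hA' _ _) <| .imp (hA' _ _) <|
      .imp (.abs_sub_lt (.coord _) (.coord _) (.const _)) (.eq (.coord _) (.coord _))
  · exact .imp (hA' _ _) <| .ex_finset Q fun q => .abs_sub_lt (.coord _) (.const _) (.const _)
  · exact .all_finset Q fun q => .ex <| .and (hA' _ _) <|
      .abs_sub_lt (.coord _) (.const _) (.const _)

theorem IsOMinimal.finite_not_stableAt (hS : S.IsOMinimal) {A : (Fin (m + 1) → ℝ) → ℝ → Prop}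
    (hA : S.DefRel₁ A) (hfin : ∀ t, {y | A t y}.Finite) (t : Fin m → ℝ) :
    {x | ¬ StableAt (fun x y => A (Fin.snoc t x) y) x}.Finite := by
  refine hS.finite_of_subset_frontier (((defRel₁_stableAt hA).defSet t).not)
    (fun p : ℕ × Finset ℚ => defSet_approxBy hA t p.1 p.2) fun x hx => ?_
  obtain ⟨n, Q, h⟩ := exists_approxBy (A := fun x y => A (Fin.snoc t x) y) (hfin (Fin.snoc t x))
  exact ⟨(n, Q), subset_closure h, fun h => hx (stableAt_of_mem_interior h)⟩

theorem defRel₁_isSample {B : (Fin m → ℝ) → ℝ → Prop} (hB : S.DefRel₁ B) :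
    S.DefRel₁ fun t σ => IsSample (B t) σ := by
  unfold IsSample
  refine .or (.eq (.coord _) (.const _)) <| .ex <| .and (hB.app (fun _ => .coord _) (.coord _)) <|
    .ex <| .and (hB.app (fun _ => .coord _) (.coord _)) <| .or ?_ <| .or ?_ ?_
  · exact .eq (.coord _) (.div_const (.add (.coord _) (.coord _)) 2)
  · exact .eq (.coord _) (.add (.coord _) (.const _))
  · exact .eq (.coord _) (.sub (.coord _) (.const _))

/-- **Uniform finiteness**: the finite fibres of a definable family of subsets of the line have
bounded size. -/
theorem IsOMinimal.exists_ncard_le (hS : S.IsOMinimal) {A : (Fin m → ℝ) → ℝ → Prop}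
    (hA : S.DefRel₁ A) (hfin : ∀ t, {y | A t y}.Finite) : ∃ K, ∀ t, {y | A t y}.ncard ≤ K := by
  induction m with
  | zero => exact ⟨{y | A 0 y}.ncard, fun t => by rw [Subsingleton.elim t 0]⟩
  | succ m ih =>
    have hBfin := hS.finite_not_stableAt hA hfin
    have hσ := defRel₁_isSample (S := S) (m := m)
      (B := fun t x => ¬ StableAt (fun x y => A (Fin.snoc t x) y) x) (defRel₁_stableAt hA).not
    have hσfin := fun t => finite_isSample (hBfin t)
    have hfin' : ∀ t, {y | ∃ σ, IsSample
        (fun x => ¬ StableAt (fun x y => A (Fin.snoc t x) y) x) σ ∧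
          A (Fin.snoc t σ) y}.Finite := fun t => by
      refine ((hσfin t).biUnion fun σ _ => hfin (Fin.snoc t σ)).subset ?_
      rintro y ⟨σ, hσ, hy⟩
      exact Set.mem_biUnion hσ hy
    obtain ⟨K, hK⟩ := ih (A := fun t y => ∃ σ, IsSample
        (fun x => ¬ StableAt (fun x y => A (Fin.snoc t x) y) x) σ ∧ A (Fin.snoc t σ) y)
      (.ex <| .and (hσ.app (fun _ => .coord _) (.coord _))
        (hA.app (.snoc (fun _ => .coord _) (.coord _)) (.coord _))) hfin'
    refine ⟨K, fun s => ?_⟩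
    obtain ⟨t, x, rfl⟩ : ∃ (t : Fin m → ℝ) (x : ℝ), s = Fin.snoc t x :=
      ⟨Fin.init s, s (Fin.last m), (Fin.snoc_init_self s).symm⟩
    obtain ⟨σ, hσ, h⟩ := exists_isSample (hBfin t) x
    have e : {y | A (Fin.snoc t x) y}.ncard = {y | A (Fin.snoc t σ) y}.ncard := by
      rcases h with rfl | h
      · rfl
      · exact ncard_eq_of_stableAt (A := fun x y => A (Fin.snoc t x) y)
          (fun x => hfin (Fin.snoc t x)) Set.ordConnected_uIcc.isPreconnected
          (fun y hy => not_not.1 (h y hy)) Set.right_mem_uIcc Set.left_mem_uIcc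
    rw [e]
    refine (Set.ncard_le_ncard ?_ (hfin' t)).trans (hK t)
    exact fun y hy => ⟨σ, hσ, hy⟩

end RealStructure

/-- Near `x`, the slices of `C` are either all empty, or all nonempty and vary in a lower
semicontinuous way. -/
def RegularAt {N : ℕ} (C : ℝ → (Fin N → ℝ) → Prop) (x : ℝ) : Prop :=
  (∀ y, C x y → ∀ ε : ℝ, 0 < ε → ∃ δ : ℝ, 0 < δ ∧ ∀ x', |x' - x| < δ →
    ∃ y', C x' y' ∧ ∀ i, |y' i - y i| < ε) ∧
  ((∃ y, C x y) ∨ ∃ δ : ℝ, 0 < δ ∧ ∀ x', |x' - x| < δ → ∀ y, ¬ C x' y)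

theorem exists_frontier_of_not_regularAt {N : ℕ} {C : ℝ → (Fin N → ℝ) → Prop} {x : ℝ}
    (h : ¬ RegularAt C x) :
    x ∈ frontier {x | ∃ y, C x y} ∨ ∃ (q : Fin N → ℚ) (r : ℚ),
      x ∈ frontier {x | ∃ y, C x y ∧ ∀ i, |y i - q i| < r} := by
  rw [RegularAt, not_and_or] at h
  rcases h with h | h
  · push Not at h
    obtain ⟨y, hy, ε, hε, h⟩ := h
    obtain ⟨r, hr, hrε⟩ := exists_rat_btwn (half_pos hε)
    have : ∀ i, ∃ q : ℚ, |y i - q| < r := fun i => by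
      obtain ⟨q, hq, hq'⟩ := exists_rat_btwn (sub_lt_self (y i) hr)
      exact ⟨q, by rw [abs_lt]; constructor <;> linarith⟩
    choose q hq using this
    refine Or.inr ⟨q, r, subset_closure ⟨y, hy, hq⟩, fun hx => ?_⟩
    obtain ⟨δ, hδ, hsub⟩ := Metric.mem_nhds_iff.1 (mem_interior_iff_mem_nhds.1 hx)
    obtain ⟨x', hx', h⟩ := h δ hδ
    obtain ⟨y', hy', hy'q⟩ := hsub (show x' ∈ Metric.ball x δ from hx')
    obtain ⟨i, hi⟩ := h y' hy'
    have a := abs_lt.1 (hq i)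
    have b := abs_lt.1 (hy'q i)
    refine hi.not_gt (abs_lt.2 ?_)
    constructor <;> linarith [a.1, a.2, b.1, b.2]
  · push Not at h
    refine Or.inl ⟨Metric.mem_closure_iff.2 fun δ hδ => ?_, fun hx => ?_⟩
    · obtain ⟨x', hx', y, hy⟩ := h.2 δ hδ
      exact ⟨x', ⟨y, hy⟩, by rwa [dist_comm]⟩
    · obtain ⟨y, hy⟩ := interior_subset hx
      exact h.1 y hy

theorem isPreconnected_slice {N : ℕ} {C : ℝ → (Fin N → ℝ) → Prop} {x : ℝ}
    (h : IsPreconnected {y | C x y}) :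
    IsPreconnected ((fun y => (Fin.cons x y : Fin (N + 1) → ℝ)) '' {y | C x y}) := by
  have hcont : Continuous fun y : Fin N → ℝ => (Fin.cons x y : Fin (N + 1) → ℝ) :=
    continuous_const.finCons continuous_id
  exact h.image _ hcont.continuousOn

theorem isPreconnected_of_subsingleton {N : ℕ} {C : ℝ → (Fin N → ℝ) → Prop}
    (hC : ∀ x, IsPreconnected {y | C x y}) {J : Set ℝ} (hJ : J.Subsingleton) :
    IsPreconnected {z : Fin (N + 1) → ℝ | z 0 ∈ J ∧ C (z 0) fun i => z i.succ} := by
  rcases hJ.eq_empty_or_singleton with rfl | ⟨x, rfl⟩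
  · simpa using isPreconnected_empty
  · convert isPreconnected_slice (hC x)
    ext z
    constructor
    · rintro ⟨rfl, h⟩
      exact ⟨_, h, Fin.cons_self_tail z⟩
    · rintro ⟨y, hy, rfl⟩
      exact ⟨rfl, hy⟩

theorem isPreconnected_of_regularAt {N : ℕ} {C : ℝ → (Fin N → ℝ) → Prop}
    (hC : ∀ x, IsPreconnected {y | C x y}) {J : Set ℝ} (hJ : IsPreconnected J)
    (hreg : ∀ x ∈ J, RegularAt C x) :
    IsPreconnected {z : Fin (N + 1) → ℝ | z 0 ∈ J ∧ C (z 0) fun i => z i.succ} := by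
  -- the set of points of the line over which the set meets the open set `u`
  have hint : ∀ u : Set (Fin (N + 1) → ℝ), IsOpen u → ∀ x ∈ J, ∀ y, C x y →
      (Fin.cons x y : Fin (N + 1) → ℝ) ∈ u →
        x ∈ interior {x | ∃ y, C x y ∧ (Fin.cons x y : Fin (N + 1) → ℝ) ∈ u} := by
    intro u hu x hx y hy hyu
    obtain ⟨ε, hε, hsub⟩ := Metric.isOpen_iff.1 hu _ hyu
    obtain ⟨δ, hδ, h⟩ := (hreg x hx).1 y hy ε hε
    refine mem_interior_iff_mem_nhds.2
      (Filter.mem_of_superset (Metric.ball_mem_nhds x (lt_min hδ hε)) fun x' hx' => ?_)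
    have hx'' : |x' - x| < min δ ε := hx'
    obtain ⟨y', hy', hyy'⟩ := h x' (hx''.trans_le (min_le_left _ _))
    refine ⟨y', hy', hsub ?_⟩
    rw [Metric.mem_ball, dist_pi_lt_iff hε]
    intro i
    induction i using Fin.cases with
    | zero => simpa [Real.dist_eq] using hx''.trans_le (min_le_right _ _)
    | succ i => simpa [Real.dist_eq] using hyy' i
  intro u v hu hv huv hneu hnev
  obtain ⟨a, ⟨haJ, haC⟩, hau⟩ := hneu
  obtain ⟨b, ⟨hbJ, hbC⟩, hbv⟩ := hnev
  have hau' := hint u hu _ haJ _ haC (by convert hau; exact Fin.cons_self_tail a)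
  have hbv' := hint v hv _ hbJ _ hbC (by convert hbv; exact Fin.cons_self_tail b)
  have hne : ∀ x ∈ J, ∃ y, C x y := by
    by_contra! hcon
    obtain ⟨c, hcJ, hc⟩ := hcon
    have hopen : ∀ x ∈ J, (∀ y, ¬ C x y) → x ∈ interior {x | ∀ y, ¬ C x y} := by
      intro x hx hxe
      obtain ⟨δ, hδ, h⟩ := (hreg x hx).2.resolve_left (by simpa using hxe)
      exact mem_interior_iff_mem_nhds.2
        (Filter.mem_of_superset (Metric.ball_mem_nhds x hδ) fun x' hx' => h x' hx')
    have hopen' := fun x hx y hy => hint Set.univ isOpen_univ x hx y hy trivial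
    obtain ⟨x, -, hx, hx'⟩ := hJ _ _ isOpen_interior isOpen_interior
      (fun x hx => (em (∃ y, C x y)).imp (fun ⟨y, hy⟩ => hopen' x hx y hy)
        fun h => hopen x hx (not_exists.1 h))
      ⟨_, haJ, hopen' _ haJ _ haC⟩ ⟨c, hcJ, hopen c hcJ hc⟩
    obtain ⟨y, hy, -⟩ := interior_subset hx
    exact interior_subset hx' y hy
  have hmem : ∀ x ∈ J, ∀ y, C x y → (Fin.cons x y : Fin (N + 1) → ℝ) ∈ u ∪ v :=
    fun x hx y hy => huv ⟨hx, hy⟩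
  obtain ⟨x, hxJ, hxu, hxv⟩ := hJ _ _ isOpen_interior isOpen_interior
    (fun x hx => by
      obtain ⟨y, hy⟩ := hne x hx
      exact (hmem x hx y hy).imp (hint u hu x hx y hy) (hint v hv x hx y hy))
    ⟨_, haJ, hau'⟩ ⟨_, hbJ, hbv'⟩
  obtain ⟨y, hy, hyu⟩ := interior_subset hxu
  obtain ⟨y', hy', hyv⟩ := interior_subset hxv
  obtain ⟨_, ⟨w, hw, rfl⟩, hwuv⟩ := isPreconnected_slice (hC x) u v hu hv
    (by rintro _ ⟨w, hw, rfl⟩; exact hmem x hxJ w hw)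
    ⟨_, ⟨y, hy, rfl⟩, hyu⟩ ⟨_, ⟨y', hy', rfl⟩, hyv⟩
  exact ⟨Fin.cons x w, ⟨hxJ, hw⟩, hwuv⟩

/-- There are at least `j` points of `B` below `x`. -/
def HasBelow (B : ℝ → Prop) : ℕ → ℝ → Prop
  | 0, _ => True
  | j + 1, x => ∃ b, b < x ∧ B b ∧ HasBelow B j b

namespace HasBelow

variable {B : ℝ → Prop} {j : ℕ} {x y : ℝ}

theorem mono (h : HasBelow B j x) (hxy : x ≤ y) : HasBelow B j y := by
  cases j with
  | zero => trivial
  | succ j =>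
    obtain ⟨b, hb, h⟩ := h
    exact ⟨b, hb.trans_le hxy, h⟩

theorem le_ncard (hB : {b | B b}.Finite) (h : HasBelow B j x) :
    j ≤ ({b | B b} ∩ Set.Iio x).ncard := by
  induction j generalizing x with
  | zero => exact Nat.zero_le _
  | succ j ih =>
    obtain ⟨b, hbx, hb, h⟩ := h
    refine (Nat.succ_le_succ (ih h)).trans ?_
    refine Set.ncard_lt_ncard (Set.ssubset_iff_of_subset ?_ |>.2 ⟨b, ⟨hb, hbx⟩, ?_⟩)
      (hB.inter_of_left _)
    · exact fun c hc => ⟨hc.1, lt_trans hc.2 hbx⟩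
    · exact fun hc => lt_irrefl b hc.2

end HasBelow

/-- There are exactly `j` points of `B` below `x`. -/
def NumBelow (B : ℝ → Prop) (j : ℕ) (x : ℝ) : Prop :=
  HasBelow B j x ∧ ¬ HasBelow B (j + 1) x

theorem exists_numBelow {B : ℝ → Prop} (hB : {b | B b}.Finite) {K : ℕ}
    (hK : {b | B b}.ncard ≤ K) (x : ℝ) : ∃ j : Fin (K + 1), NumBelow B j x := by
  by_contra! hcon
  have h : ∀ j, j ≤ K + 1 → HasBelow B j x := fun j hj => by
    induction j with
    | zero => trivial
    | succ j ih =>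
      by_contra h
      exact hcon ⟨j, by omega⟩ ⟨ih (by omega), h⟩
  have := (h _ le_rfl).le_ncard hB
  have := Set.ncard_le_ncard (Set.inter_subset_left (s := {b | B b}) (t := Set.Iio x)) hB
  omega

theorem ordConnected_numBelow (B : ℝ → Prop) (j : ℕ) :
    {x | NumBelow B j x ∧ ¬ B x}.OrdConnected := by
  refine ⟨fun x hx z hz y hy => ?_⟩
  have h : NumBelow B j y := ⟨hx.1.1.mono hy.1, fun h => hz.1.2 (h.mono hy.2)⟩
  refine ⟨h, fun hBy => ?_⟩
  rcases hy.2.eq_or_lt with rfl | hyz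
  · exact hz.2 hBy
  · exact hz.1.2 ⟨y, hyz, hBy, h.1⟩

theorem subsingleton_numBelow (B : ℝ → Prop) (j : ℕ) :
    {x | NumBelow B j x ∧ B x}.Subsingleton := by
  intro x hx y hy
  rcases lt_trichotomy x y with h | h | h
  · exact absurd ⟨x, h, hx.2, hx.1.1⟩ hy.1.2
  · exact h
  · exact absurd ⟨y, h, hy.2, hy.1.1⟩ hx.1.2

namespace RealStructure

variable {S : RealStructure} {M N : ℕ}

theorem defRel₁_regularAt {C : (Fin (M + 1) → ℝ) → (Fin N → ℝ) → Prop} (hC : S.DefRel C) :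
    S.DefRel₁ fun (t : Fin M → ℝ) x => RegularAt (fun x y => C (Fin.snoc t x) y) x := by
  unfold RegularAt
  refine .and (.allVec <| .imp (hC.app (.snoc (fun _ => .coord _) (.coord _)) fun _ => .coord _) <|
    .all <| .imp (.lt (.const _) (.coord _)) <| .ex <| .and (.lt (.const _) (.coord _)) <|
    .all <| .imp (.abs_sub_lt (.coord _) (.coord _) (.coord _)) <| .exVec <|
    .and (hC.app (.snoc (fun _ => .coord _) (.coord _)) fun _ => .coord _) <|
    .all_fin fun i => .abs_sub_lt (.coord _) (.coord _) (.coord _)) <|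
    .or (.exVec (hC.app (.snoc (fun _ => .coord _) (.coord _)) fun _ => .coord _)) <|
    .ex <| .and (.lt (.const _) (.coord _)) <|
    .all <| .imp (.abs_sub_lt (.coord _) (.coord _) (.coord _)) <| .allVec <|
    .not (hC.app (.snoc (fun _ => .coord _) (.coord _)) fun _ => .coord _)

theorem IsOMinimal.finite_not_regularAt (hS : S.IsOMinimal)
    {C : (Fin (M + 1) → ℝ) → (Fin N → ℝ) → Prop} (hC : S.DefRel C) (t : Fin M → ℝ) :
    {x | ¬ RegularAt (fun x y => C (Fin.snoc t x) y) x}.Finite := by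
  refine hS.finite_of_subset_frontier (((defRel₁_regularAt hC).defSet t).not)
    (W := fun p : Option ((Fin N → ℚ) × ℚ) => p.elim {x | ∃ y, C (Fin.snoc t x) y}
      fun p => {x | ∃ y, C (Fin.snoc t x) y ∧ ∀ i, |y i - p.1 i| < p.2}) ?_ fun x hx => ?_
  · rintro (_ | ⟨q, r⟩)
    · exact .exVec (hC.app (.snoc (fun _ => .const _) (.coord _)) fun _ => .coord _)
    · exact .exVec <| .and (hC.app (.snoc (fun _ => .const _) (.coord _)) fun _ => .coord _) <|
        .all_fin fun i => .abs_sub_lt (.coord _) (.const _) (.const _)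
  · rcases exists_frontier_of_not_regularAt hx with h | ⟨q, r, h⟩
    · exact ⟨none, h⟩
    · exact ⟨some (q, r), h⟩

theorem defRel₁_hasBelow {B : (Fin M → ℝ) → ℝ → Prop} (hB : S.DefRel₁ B) (j : ℕ) :
    S.DefRel₁ fun t x => HasBelow (B t) j x := by
  induction j with
  | zero => exact .const True
  | succ j ih =>
    exact .ex <| .and (.lt (.coord _) (.coord _)) <|
      .and (hB.app (fun _ => .coord _) (.coord _)) (ih.app (fun _ => .coord _) (.coord _))

/-- A definable family is a finite union of definable families with preconnected fibres. -/
theorem IsOMinimal.exists_preconnected_cover (hS : S.IsOMinimal)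
    {P : (Fin M → ℝ) → (Fin N → ℝ) → Prop} (hP : S.DefRel P) :
    ∃ (ι : Type) (_ : Finite ι) (V : ι → (Fin M → ℝ) → (Fin N → ℝ) → Prop),
      (∀ i, S.DefRel (V i)) ∧ (∀ t x, P t x ↔ ∃ i, V i t x) ∧
        ∀ i t, IsPreconnected {x | V i t x} := by
  induction N generalizing M with
  | zero =>
    exact ⟨Unit, inferInstance, fun _ => P, fun _ => hP, fun t x => by simp,
      fun _ t => Set.subsingleton_of_subsingleton.isPreconnected⟩
  | succ N ih =>
    obtain ⟨ι, _, C, hC, hPC, hconn⟩ := ih (M := M + 1)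
      (P := fun s y => P (fun i => s i.castSucc) (Fin.cons (s (Fin.last M)) y))
      (hP.app (fun _ => .coord _) (.cons (.coord _) fun _ => .coord _))
    have hBfin := fun i t => hS.finite_not_regularAt (hC i) t
    have hB : ∀ i, S.DefRel₁ fun t x => ¬ RegularAt (fun x y => C i (Fin.snoc t x) y) x :=
      fun i => (defRel₁_regularAt (hC i)).not
    choose K hK using fun i => hS.exists_ncard_le (hB i) (hBfin i)
    have hdef : ∀ i j, S.DefRel fun (t : Fin M → ℝ) (z : Fin (N + 1) → ℝ) =>
        NumBelow (fun x => ¬ RegularAt (fun x y => C i (Fin.snoc t x) y) x) j (z 0) :=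
      fun i j => .and ((defRel₁_hasBelow (hB i) j).app (fun _ => .coord _) (.coord _))
        ((defRel₁_hasBelow (hB i) (j + 1)).app (fun _ => .coord _) (.coord _)).not
    have hdef' : ∀ i, S.DefRel fun (t : Fin M → ℝ) (z : Fin (N + 1) → ℝ) =>
        C i (Fin.snoc t (z 0)) fun l => z l.succ :=
      fun i => (hC i).app (.snoc (fun _ => .coord _) (.coord _)) fun _ => .coord _
    refine ⟨(Σ i, Fin (K i + 1)) ⊕ (Σ i, Fin (K i + 1)), inferInstance, Sum.elim
      (fun p t z => (NumBelow (fun x => ¬ RegularAt (fun x y => C p.1 (Fin.snoc t x) y) x) p.2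
        (z 0) ∧ ¬ ¬ RegularAt (fun x y => C p.1 (Fin.snoc t x) y) (z 0)) ∧
          C p.1 (Fin.snoc t (z 0)) fun l => z l.succ)
      (fun p t z => (NumBelow (fun x => ¬ RegularAt (fun x y => C p.1 (Fin.snoc t x) y) x) p.2
        (z 0) ∧ ¬ RegularAt (fun x y => C p.1 (Fin.snoc t x) y) (z 0)) ∧
          C p.1 (Fin.snoc t (z 0)) fun l => z l.succ), ?_, fun t z => ?_, ?_⟩
    · rintro (⟨i, j⟩ | ⟨i, j⟩)
      · exact .and (.and (hdef i j) ((hB i).app (fun _ => .coord _) (.coord _)).not) (hdef' i)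
      · exact .and (.and (hdef i j) ((hB i).app (fun _ => .coord _) (.coord _))) (hdef' i)
    · have h := hPC (Fin.snoc t (z 0)) fun l => z l.succ
      have e : (Fin.cons (z 0) fun l => z l.succ : Fin (N + 1) → ℝ) = z := Fin.cons_self_tail z
      simp only [Fin.snoc_castSucc, Fin.snoc_last, e] at h
      rw [h]
      constructor
      · rintro ⟨i, hi⟩
        obtain ⟨j, hj⟩ := exists_numBelow (hBfin i t) (hK i t) (z 0)
        by_cases hreg : RegularAt (fun x y => C i (Fin.snoc t x) y) (z 0)
        · exact ⟨.inl ⟨i, j⟩, ⟨hj, not_not.2 hreg⟩, hi⟩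
        · exact ⟨.inr ⟨i, j⟩, ⟨hj, hreg⟩, hi⟩
      · rintro ⟨⟨i, j⟩ | ⟨i, j⟩, h⟩ <;> exact ⟨i, h.2⟩
    · rintro (⟨i, j⟩ | ⟨i, j⟩) t
      · exact isPreconnected_of_regularAt (C := fun x y => C i (Fin.snoc t x) y)
          (fun x => hconn i (Fin.snoc t x)) (ordConnected_numBelow _ j).isPreconnected
          fun x hx => not_not.1 hx.2
      · exact isPreconnected_of_subsingleton (C := fun x y => C i (Fin.snoc t x) y)
          (fun x => hconn i (Fin.snoc t x)) (subsingleton_numBelow _ j)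

end RealStructure

theorem card_connectedComponents_le {X : Type*} [TopologicalSpace X] {ι : Type*} [Finite ι]
    {s : Set X} (V : ι → Set X) (hs : s = ⋃ i, V i) (hV : ∀ i, IsPreconnected (V i)) :
    Finite (ConnectedComponents s) ∧ Nat.card (ConnectedComponents s) ≤ Nat.card ι := by
  have h : ∀ c : ConnectedComponents s, ∃ i, ∃ x : s, (x : ConnectedComponents s) = c ∧
      (x : X) ∈ V i := fun c => by
    obtain ⟨x, rfl⟩ := ConnectedComponents.surjective_coe c
    obtain ⟨i, hi⟩ := Set.mem_iUnion.1 (hs.subset x.2)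
    exact ⟨i, x, rfl, hi⟩
  choose φ r hr hrV using h
  have hinj : Function.Injective φ := fun c d hcd => by
    rw [← hr c, ← hr d, ConnectedComponents.coe_eq_coe']
    have hpre : IsPreconnected (Subtype.val ⁻¹' V (φ d) : Set s) := by
      rw [← Topology.IsInducing.subtypeVal.isPreconnected_image,
        Subtype.image_preimage_coe, Set.inter_eq_right.2]
      · exact hV _
      · exact hs ▸ Set.subset_iUnion V _
    exact hpre.subset_connectedComponent (hrV d) (show (r c : X) ∈ V (φ d) from hcd ▸ hrV c)
  exact ⟨Finite.of_injective φ hinj, Nat.card_le_card_of_injective φ hinj⟩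

/-- **Proposition (uniform finiteness in o-minimal families).** If `U ⊆ ℝ^{M} × ℝ^{N}` is a
definable family in a fixed o-minimal structure, then there is an integer `n` such that every
fiber `U_t`, `t ∈ ℝ^M`, has at most `n` connected components. -/
theorem statement4 (S : RealStructure) (hS : S.IsOMinimal) (M N : ℕ)
    (U : Set (Fin (M + N) → ℝ)) (hU : U ∈ S.sets (M + N)) :
    ∃ n : ℕ, ∀ t : Fin M → ℝ,
      Finite (ConnectedComponents ↥{x : Fin N → ℝ | Fin.append t x ∈ U}) ∧
      Nat.card (ConnectedComponents ↥{x : Fin N → ℝ | Fin.append t x ∈ U}) ≤ n := by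
  have hP : S.DefRel fun (t : Fin M → ℝ) (x : Fin N → ℝ) => Fin.append t x ∈ U := by
    refine RealStructure.Def.subst (P := fun z => z ∈ U) hU ?_
    exact .append (fun _ => .coord _) fun _ => .coord _
  obtain ⟨ι, _, V, -, hV, hconn⟩ := hS.exists_preconnected_cover hP
  refine ⟨Nat.card ι, fun t => card_connectedComponents_le (fun i => {x | V i t x}) ?_
    fun i => hconn i t⟩
  ext x
  simpa using hV t x
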